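/- arXiv:1304.5643 — 4 statements merged into one kernel-verified Lean document; each statement's English description precedes it below -/
import Mathlib

section
/- Idempotence of canonisation: let (I, δ) be a timely specification. Then the canonical form of the restriction of δ̂ to pairs of distinct elements equals δ̂ on pairs of distinct elements, i.e. (δ̂)̂ = δ̂ on {(i,j) ∈ I × I : i ≠ j}. -/
noncomputable section

/-- `D ≤ ℝ` (an additive subgroup) is closed under infima of nonempty
bounded-below subsets. -/
def ClosedUnderInf (D : AddSubgroup ℝ) : Prop :=
  ∀ S : Set ℝ, S.Nonempty → BddBelow S → S ⊆ (D : Set ℝ) → sInf S ∈ D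

/-- A timely constraint on `I`: on every pair of distinct actions, `δ` takes a value
in `Δ = D ∪ {-∞, +∞}`, viewed inside the extended reals. -/
def IsTimelyConstraint (D : AddSubgroup ℝ) {I : Type*} (δ : I → I → EReal) : Prop :=
  ∀ i j : I, i ≠ j → δ i j = ⊤ ∨ δ i j = ⊥ ∨ ∃ d : ℝ, d ∈ D ∧ δ i j = (d : EReal)

/-- `t : I → ℝ` takes values in `𝕋` (the nonnegative part of `D`) and satisfies the
timely constraint `δ`, i.e. `t j ≤ t i + δ i j` for all distinct `i, j`. -/
def Satisfies (D : AddSubgroup ℝ) {I : Type*} (δ : I → I → EReal) (t : I → ℝ) : Prop :=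
  (∀ i, t i ∈ D) ∧ (∀ i, 0 ≤ t i) ∧
    ∀ i j : I, i ≠ j → (t j : EReal) ≤ (t i : EReal) + δ i j

/-- A path in the graph `G_δ`: a nonempty finite sequence of vertices, each consecutive
pair being an edge, i.e. a pair of distinct vertices with `δ < ∞`. -/
def IsPath {I : Type*} (δ : I → I → EReal) (p : List I) : Prop :=
  p ≠ [] ∧ p.Chain' fun a b => a ≠ b ∧ δ a b < ⊤

/-- The length of a path: the sum of the weights of its edges. -/
def pathLength {I : Type*} (δ : I → I → EReal) (p : List I) : EReal :=
  ((p.zip p.tail).map fun q => δ q.1 q.2).sum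

/-- The canonical form `δ̂` of `δ`: the distance function of `G_δ`, i.e. the infimum in
the extended reals of the lengths of all paths from `i` to `j` (`+∞` if there is none). -/
def canon {I : Type*} (δ : I → I → EReal) (i j : I) : EReal :=
  sInf {L : EReal | ∃ p : List I,
    IsPath δ p ∧ p.head? = some i ∧ p.getLast? = some j ∧ pathLength δ p = L}

/-- A negative cycle in `G_δ`: a path with at least two entries, whose first and last
vertices coincide, of negative length. -/
def IsNegativeCycle {I : Type*} (δ : I → I → EReal) (p : List I) : Prop :=
  IsPath δ p ∧ 2 ≤ p.length ∧ p.head? = p.getLast? ∧ pathLength δ p < 0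

theorem pathLength_singleton {I : Type*} (δ : I → I → EReal) (a : I) :
    pathLength δ [a] = 0 := by
  simp [pathLength]

theorem pathLength_cons_cons {I : Type*} (δ : I → I → EReal) (a b : I) (l : List I) :
    pathLength δ (a :: b :: l) = δ a b + pathLength δ (b :: l) := by
  simp [pathLength]

theorem isPath_singleton {I : Type*} (δ : I → I → EReal) (a : I) : IsPath δ [a] :=
  ⟨List.cons_ne_nil _ _, List.isChain_singleton _⟩

theorem isPath_cons_cons {I : Type*} {δ : I → I → EReal} {a b : I} {l : List I} :
    IsPath δ (a :: b :: l) ↔ (a ≠ b ∧ δ a b < ⊤) ∧ IsPath δ (b :: l) := by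
  refine ⟨fun h => ?_, fun h => ⟨List.cons_ne_nil _ _, ?_⟩⟩
  · obtain ⟨h₁, h₂⟩ := List.isChain_cons_cons.1 h.2
    exact ⟨h₁, List.cons_ne_nil _ _, h₂⟩
  · exact List.isChain_cons_cons.2 ⟨h.1, h.2.2⟩

theorem canon_le_pathLength {I : Type*} {δ : I → I → EReal} {i j : I} {p : List I}
    (hp : IsPath δ p) (hi : p.head? = some i) (hj : p.getLast? = some j) :
    canon δ i j ≤ pathLength δ p :=
  sInf_le ⟨p, hp, hi, hj, rfl⟩

/-- Paths can be concatenated, and their lengths add up. -/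
theorem IsPath.exists_concat {I : Type*} {δ : I → I → EReal} {b c : I} {q : List I}
    (hq : IsPath δ q) (hqb : q.head? = some b) (hqc : q.getLast? = some c) {p : List I}
    (hp : IsPath δ p) (hpb : p.getLast? = some b) :
    ∃ r, IsPath δ r ∧ r.head? = p.head? ∧ r.getLast? = some c ∧
      pathLength δ r = pathLength δ p + pathLength δ q := by
  induction p with
  | nil => exact absurd rfl hp.1
  | cons x l ih =>
    cases l with
    | nil =>
      obtain rfl : x = b := by simpa using hpb
      exact ⟨q, hq, by simpa using hqb, hqc, by rw [pathLength_singleton, zero_add]⟩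
    | cons y l =>
      obtain ⟨hxy, hl⟩ := isPath_cons_cons.1 hp
      obtain ⟨r, hr, hry, hrc, hlen⟩ := ih hl (by simpa using hpb)
      cases r with
      | nil => exact absurd rfl hr.1
      | cons z r =>
        obtain rfl : z = y := by simpa using hry
        refine ⟨x :: z :: r, isPath_cons_cons.2 ⟨hxy, hr⟩, rfl, by simpa using hrc, ?_⟩
        rw [pathLength_cons_cons, pathLength_cons_cons, hlen, add_assoc]

/-- The triangle inequality for the distance function. -/
theorem canon_triangle {I : Type*} {δ : I → I → EReal} {a b c : I}
    (hab : canon δ a b ≠ ⊤) (hbc : canon δ b c ≠ ⊤) :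
    canon δ a c ≤ canon δ a b + canon δ b c := by
  refine EReal.le_add_of_forall_gt (Or.inr hbc) (Or.inl hab) fun x hx y hy => ?_
  obtain ⟨_, ⟨p, hp, hpa, hpb, rfl⟩, hpx⟩ := sInf_lt_iff.1 hx
  obtain ⟨_, ⟨q, hq, hqb, hqc, rfl⟩, hqy⟩ := sInf_lt_iff.1 hy
  obtain ⟨r, hr, hra, hrc, hlen⟩ := hq.exists_concat hqb hqc hp hpb
  calc canon δ a c ≤ pathLength δ r := canon_le_pathLength hr (hra.trans hpa) hrc
    _ = pathLength δ p + pathLength δ q := hlen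
    _ ≤ x + y := add_le_add hpx.le hqy.le

/-- The distance is bounded by, and finite along, paths of the distance graph. -/
theorem canon_le_pathLength_canon {I : Type*} {δ : I → I → EReal} {j : I} {p : List I}
    (hp : IsPath (canon δ) p) (hj : p.getLast? = some j) {i : I} (hi : p.head? = some i) :
    canon δ i j ≤ pathLength (canon δ) p ∧ canon δ i j ≠ ⊤ := by
  induction p generalizing i with
  | nil => exact absurd rfl hp.1
  | cons x l ih =>
    obtain rfl : x = i := by simpa using hi
    cases l with
    | nil =>
      obtain rfl : x = j := by simpa using hj
      have h : canon δ x x ≤ 0 := by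
        simpa only [pathLength_singleton] using
          canon_le_pathLength (j := x) (isPath_singleton δ x) rfl rfl
      exact ⟨by rwa [pathLength_singleton], (h.trans_lt EReal.zero_lt_top).ne⟩
    | cons y l =>
      obtain ⟨hxy, hl⟩ := isPath_cons_cons.1 hp
      obtain ⟨hle, htop⟩ := ih hl (by simpa using hj) rfl
      have htri := canon_triangle hxy.2.ne htop
      rw [pathLength_cons_cons]
      exact ⟨htri.trans (add_le_add le_rfl hle),
        (htri.trans_lt (EReal.add_lt_top hxy.2.ne htop)).ne⟩

/-- Idempotence of canonisation: `(δ̂)̂ = δ̂` on pairs of distinct elements. -/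
theorem canon_idem (D : AddSubgroup ℝ) (hD : ClosedUnderInf D)
    {I : Type*} (δ : I → I → EReal) (hδ : IsTimelyConstraint D δ)
    (i j : I) (hij : i ≠ j) :
    canon (fun a b => canon δ a b) i j = canon δ i j := by
  apply le_antisymm
  · rcases eq_or_ne (canon δ i j) ⊤ with h | h
    · exact h ▸ le_top
    · have hp : IsPath (canon δ) [i, j] :=
        isPath_cons_cons.2 ⟨⟨hij, h.lt_top⟩, isPath_singleton _ _⟩
      simpa only [pathLength_cons_cons, pathLength_singleton, add_zero] using
        canon_le_pathLength (j := j) hp rfl rfl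
  · refine le_sInf ?_
    rintro _ ⟨p, hp, hi, hj, rfl⟩
    exact (canon_le_pathLength_canon hp hj hi).1
end
end

section
/- Equivalence of a timely constraint with its canonical form: let (I, δ) be a timely specification. Then T(δ̂) = T(δ), i.e. a function t : I → 𝕋 satisfies t(j) ≤ t(i) + δ̂(i,j) for all distinct i, j if and only if it satisfies t(j) ≤ t(i) + δ(i,j) for all distinct i, j. -/
noncomputable section

/-- The canonical form is bounded above by the constraint on distinct pairs. -/
theorem canon_le {I : Type*} (δ : I → I → EReal) {i j : I} (hij : i ≠ j) :
    canon δ i j ≤ δ i j := by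
  rcases eq_or_ne (δ i j) ⊤ with h | h
  · exact h ▸ le_top
  · refine sInf_le ⟨[i, j], ⟨by simp, ?_⟩, by simp, by simp, by simp [pathLength]⟩
    exact List.isChain_pair.2 ⟨hij, lt_top_iff_ne_top.2 h⟩

/-- Along a path, the constraints accumulate to a bound by the length of the path. -/
theorem le_add_pathLength {I : Type*} {δ : I → I → EReal} {t : I → ℝ}
    (ht : ∀ i j : I, i ≠ j → (t j : EReal) ≤ (t i : EReal) + δ i j)
    {p : List I} (hp : IsPath δ p) {i j : I} (hi : p.head? = some i)
    (hj : p.getLast? = some j) : (t j : EReal) ≤ (t i : EReal) + pathLength δ p := by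
  obtain ⟨-, hchain⟩ := hp
  induction p generalizing i with
  | nil => simp at hi
  | cons a q ih =>
    obtain rfl : a = i := by simpa using hi
    cases q with
    | nil =>
      obtain rfl : a = j := by simpa using hj
      simp [pathLength]
    | cons b r =>
      obtain ⟨⟨hab, -⟩, hr⟩ := List.isChain_cons_cons.1 hchain
      calc (t j : EReal) ≤ t b + pathLength δ (b :: r) :=
            ih (by simp) (by simpa using hj) hr
        _ ≤ (t a + δ a b) + pathLength δ (b :: r) := by gcongr; exact ht a b hab
        _ = t a + pathLength δ (a :: b :: r) := by simp [pathLength, add_assoc]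

/-- Equivalence: `T(δ̂) = T(δ)`. -/
theorem satisfies_canon_iff (D : AddSubgroup ℝ) (hD : ClosedUnderInf D)
    {I : Type*} (δ : I → I → EReal) (hδ : IsTimelyConstraint D δ) :
    {t : I → ℝ | Satisfies D (canon δ) t} = {t : I → ℝ | Satisfies D δ t} := by
  ext t
  refine and_congr_right fun _ => and_congr_right fun _ => ⟨fun h i j hij => ?_, fun h i j _ => ?_⟩
  · exact (h i j hij).trans (by gcongr; exact canon_le δ hij)
  · have key : (t j : EReal) - t i ≤ canon δ i j := by
      refine le_sInf ?_
      rintro _ ⟨p, hp, hi, hj, rfl⟩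
      exact EReal.sub_le_of_le_add' (le_add_pathLength h hp hi hj)
    rw [add_comm]
    exact (EReal.sub_le_iff_le_add (by simp) (by simp)).1 key
end
end

section
/- Satisfiability criterion, finite case: let (I, δ) be a timely specification with I finite and δ(i,j) > −∞ for every pair of distinct i, j ∈ I. Then δ is satisfiable if and only if G_δ contains no negative cycles. -/
noncomputable section

/-- The sum of the real weights `w a b` over consecutive entries `a, b` of a list. -/
def weightSum {I : Type*} (w : I → I → ℝ) : List I → ℝ
  | [] => 0
  | [_] => 0
  | a :: b :: l => w a b + weightSum w (b :: l)

theorem weightSum_append_cons {I : Type*} (w : I → I → ℝ) (l : List I) (i : I) (m : List I) :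
    weightSum w (l ++ i :: m) = weightSum w (l ++ [i]) + weightSum w (i :: m) := by
  induction l with
  | nil => simp [weightSum]
  | cons a l ih =>
    cases l with
    | nil => simp [weightSum]
    | cons b l =>
      simp only [List.cons_append, weightSum] at ih ⊢
      rw [ih, add_assoc]

theorem weightSum_mem {I : Type*} {w : I → I → ℝ} {D : AddSubgroup ℝ} {p : List I}
    (hp : p.IsChain fun a b => w a b ∈ D) : weightSum w p ∈ D := by
  induction p with
  | nil => exact D.zero_mem
  | cons a l ih =>
    cases l with
    | nil => exact D.zero_mem
    | cons b l =>
      rw [List.isChain_cons_cons] at hp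
      exact D.add_mem hp.1 (ih hp.2)

theorem pathLength_eq_weightSum {I : Type*} {δ : I → I → EReal} {w : I → I → ℝ} {p : List I}
    (hp : p.IsChain fun a b => δ a b = w a b) : pathLength δ p = weightSum w p := by
  induction p with
  | nil => simp [pathLength, weightSum]
  | cons a l ih =>
    cases l with
    | nil => simp [pathLength, weightSum]
    | cons b l =>
      rw [List.isChain_cons_cons] at hp
      have h := ih hp.2
      simp only [pathLength, List.tail_cons, List.zip_cons_cons, List.map_cons,
        List.sum_cons, weightSum, EReal.coe_add] at h ⊢
      rw [h, hp.1]

theorem getLast_le_head_add_weightSum {I : Type*} {w : I → I → ℝ} {t : I → ℝ} (a : I)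
    (l : List I) (hp : (a :: l).IsChain fun a b => t b ≤ t a + w a b) :
    t ((a :: l).getLast (List.cons_ne_nil a l)) ≤ t a + weightSum w (a :: l) := by
  induction l generalizing a with
  | nil => simp [weightSum]
  | cons b l ih =>
    rw [List.isChain_cons_cons] at hp
    have h := ih b hp.2
    rw [List.getLast_cons (List.cons_ne_nil b l), weightSum]
    linarith [hp.1]

/-- If every closed chain of `R` has nonnegative weight, then there is a nonnegative potential,
given at each vertex by minus the weight of a chain starting there. -/
theorem exists_potential {I : Type*} [Finite I] (R : I → I → Prop) (w : I → I → ℝ)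
    (hw : ∀ i l, (i :: l ++ [i]).IsChain R → 0 ≤ weightSum w (i :: l ++ [i])) :
    ∃ p : I → List I, (∀ i, (p i).IsChain R) ∧ (∀ i, weightSum w (p i) ≤ 0) ∧
      ∀ i j, R i j → weightSum w (p i) ≤ w i j + weightSum w (p j) := by
  classical
  have := Fintype.ofFinite I
  have hfin (i : I) : {p : List I | p.IsChain R ∧ p.Nodup ∧ p.head? = some i}.Finite :=
    (List.finite_length_le I (Fintype.card I)).subset fun p hp => hp.2.1.length_le_card
  have hsing (i : I) : [i] ∈ {p : List I | p.IsChain R ∧ p.Nodup ∧ p.head? = some i} := by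
    simp
  choose p hp hmin using fun i => Set.exists_min_image _ (weightSum w) (hfin i) ⟨[i], hsing i⟩
  refine ⟨p, fun i => (hp i).1, fun i => hmin i _ (hsing i), fun i j hij => ?_⟩
  obtain ⟨hc, hn, hh⟩ := hp j
  obtain ⟨q, hq⟩ := List.head?_eq_some_iff.mp hh
  have hcons : weightSum w (i :: p j) = w i j + weightSum w (p j) := by rw [hq, weightSum]
  have hchain : (i :: p j).IsChain R := by
    rw [hq] at hc ⊢
    exact List.isChain_cons_cons.mpr ⟨hij, hc⟩
  rw [← hcons]
  by_cases hi : i ∈ p j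
  · obtain ⟨a, b, hab⟩ := List.append_of_mem hi
    have hsplit : i :: p j = (i :: a) ++ i :: b := by rw [hab, List.cons_append]
    rw [hsplit] at hchain ⊢
    rw [weightSum_append_cons]
    have hcycle : (i :: a ++ [i]).IsChain R :=
      hchain.prefix ⟨b, by simp⟩
    have hle := hmin i (i :: b) ⟨hchain.suffix ⟨i :: a, rfl⟩,
      hn.sublist (hab ▸ List.sublist_append_right a (i :: b)), rfl⟩
    linarith [hw i a hcycle]
  · exact hmin i _ ⟨hchain, List.nodup_cons.mpr ⟨hi, hn⟩, rfl⟩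

/-- Satisfiability criterion, finite case: if `I` is finite and
`δ > -∞` on distinct pairs, then `δ` is satisfiable iff `G_δ` has no negative cycle. -/
theorem satisfiable_iff_no_negCycle (D : AddSubgroup ℝ) (hD : ClosedUnderInf D)
    {I : Type*} [Finite I] (δ : I → I → EReal) (hδ : IsTimelyConstraint D δ)
    (hbot : ∀ i j : I, i ≠ j → δ i j ≠ ⊥) :
    (∃ t : I → ℝ, Satisfies D δ t) ↔ ¬∃ p : List I, IsNegativeCycle δ p := by
  have hcoe (a b : I) (h : a ≠ b ∧ δ a b < ⊤) : δ a b = ((δ a b).toReal : EReal) :=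
    (EReal.coe_toReal h.2.ne (hbot a b h.1)).symm
  constructor
  · rintro ⟨t, -, -, ht⟩ ⟨p, ⟨hne, hc⟩, -, hhl, hneg⟩
    obtain ⟨a, l, rfl⟩ := List.exists_cons_of_ne_nil hne
    rw [pathLength_eq_weightSum (hc.imp hcoe), EReal.coe_neg'] at hneg
    have hle := getLast_le_head_add_weightSum (t := t) a l (hc.imp fun a b h => by
      have hab := ht a b h.1
      rw [hcoe a b h] at hab
      exact_mod_cast hab)
    rw [List.head?_cons, List.getLast?_eq_getLast_of_ne_nil (List.cons_ne_nil a l),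
      Option.some_inj] at hhl
    rw [← hhl] at hle
    linarith
  · intro hno
    obtain ⟨p, hc, hnonpos, hp⟩ := exists_potential (fun a b => a ≠ b ∧ δ a b < ⊤)
      (fun a b => (δ a b).toReal) fun i l hil => by
        by_contra! hlt
        refine hno ⟨i :: l ++ [i], ⟨by simp, hil⟩, by simp,
          List.getLast?_concat.symm, ?_⟩
        rw [pathLength_eq_weightSum (hil.imp hcoe)]
        exact_mod_cast hlt
    refine ⟨fun i => -weightSum (fun a b => (δ a b).toReal) (p i), fun i => ?_,
      fun i => neg_nonneg.mpr (hnonpos i), fun i j hij => ?_⟩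
    · refine D.neg_mem (weightSum_mem ((hc i).imp fun a b h => ?_))
      obtain htop | hb | ⟨d, hd, hab⟩ := hδ a b h.1
      · exact absurd htop h.2.ne
      · exact absurd hb (hbot a b h.1)
      · rwa [hab, EReal.toReal_coe]
    · by_cases htop : δ i j = ⊤
      · simp [htop]
      · have hR : i ≠ j ∧ δ i j < ⊤ := ⟨hij, lt_top_iff_ne_top.mpr htop⟩
        rw [hcoe i j hR, ← EReal.coe_add, EReal.coe_le_coe_iff]
        linarith [hp i j hR]
end
end

section
/- Unboundedness at infinite canonical constraints: let (I, δ) be a timely specification with δ satisfiable, and let ĩ, j̃ ∈ I. If δ̂(ĩ,j̃) = ∞, then for every K ∈ 𝕋 there exists t ∈ T(δ) with t(j̃) − t(ĩ) ≥ K. -/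
noncomputable section

theorem pathLength_lt_top_of_isChain {I : Type*} {δ : I → I → EReal} :
    ∀ p : List I, p.IsChain (fun a b => a ≠ b ∧ δ a b < ⊤) → pathLength δ p < ⊤
  | [], _ => by simp [pathLength]
  | [_], _ => by simp [pathLength]
  | a :: b :: l, h => by
    rw [List.isChain_cons_cons] at h
    have ih := pathLength_lt_top_of_isChain (b :: l) h.2
    have hsum : pathLength δ (a :: b :: l) = δ a b + pathLength δ (b :: l) := by
      simp [pathLength]
    rw [hsum]
    exact EReal.add_lt_top h.1.2.ne ih.ne

theorem canon_lt_top_of_reflTransGen {I : Type*} {δ : I → I → EReal} {i j : I}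
    (h : Relation.ReflTransGen (fun a b => a ≠ b ∧ δ a b < ⊤) i j) : canon δ i j < ⊤ := by
  obtain ⟨l, hl, hlast⟩ := List.exists_isChain_cons_of_relationReflTransGen h
  refine lt_of_le_of_lt (sInf_le ⟨i :: l, ⟨List.cons_ne_nil _ _, hl⟩, rfl, ?_, rfl⟩)
    (pathLength_lt_top_of_isChain _ hl)
  rw [List.getLast?_eq_getLast_of_ne_nil (List.cons_ne_nil _ _), hlast]

/-- Delaying every vertex outside a set closed under the edges of `G_δ` by the same
amount preserves satisfaction of `δ`. -/
theorem Satisfies.delay_compl {D : AddSubgroup ℝ} {I : Type*} {δ : I → I → EReal}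
    {t : I → ℝ} (ht : Satisfies D δ t) {R : Set I} [DecidablePred (· ∈ R)]
    (hR : ∀ i ∈ R, ∀ j, i ≠ j → δ i j < ⊤ → j ∈ R) {c : ℝ} (hcD : c ∈ D) (hc : 0 ≤ c) :
    Satisfies D δ fun i => if i ∈ R then t i else t i + c := by
  obtain ⟨htD, ht₀, hle⟩ := ht
  refine ⟨fun i => ?_, fun i => ?_, fun i j hij => ?_⟩
  · dsimp only
    split_ifs
    exacts [htD i, D.add_mem (htD i) hcD]
  · dsimp only
    split_ifs
    exacts [ht₀ i, add_nonneg (ht₀ i) hc]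
  · have hc' : (0 : EReal) ≤ c := EReal.coe_nonneg.2 hc
    have h := hle i j hij
    dsimp only
    split_ifs with hj hi hi
    · exact h
    · refine h.trans (add_le_add_left ?_ _)
      exact EReal.coe_le_coe_iff.2 (le_add_of_nonneg_right hc)
    · have htop : δ i j = ⊤ := by
        by_contra hne
        exact hj (hR i hi j hij (lt_top_iff_ne_top.2 hne))
      simp [htop]
    · rw [EReal.coe_add, EReal.coe_add, add_right_comm]
      exact add_le_add_left h _

/-- Unboundedness at infinite canonical constraints: if `δ` is satisfiable
and `δ̂(i₀,j₀) = ∞`, then for every `K ∈ 𝕋` some `t ∈ T(δ)` has `t(j₀) - t(i₀) ≥ K`. -/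
theorem canon_top_unbounded (D : AddSubgroup ℝ) (hD : ClosedUnderInf D)
    {I : Type*} (δ : I → I → EReal) (hδ : IsTimelyConstraint D δ)
    (hsat : ∃ t : I → ℝ, Satisfies D δ t) (i₀ j₀ : I)
    (htop : canon δ i₀ j₀ = ⊤) :
    ∀ K : ℝ, K ∈ D → 0 ≤ K →
      ∃ t : I → ℝ, Satisfies D δ t ∧ K ≤ t j₀ - t i₀ := by
  classical
  intro K hKD hK
  obtain ⟨t, ht⟩ := hsat
  let R : Set I := {j | Relation.ReflTransGen (fun a b => a ≠ b ∧ δ a b < ⊤) i₀ j}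
  have hi₀ : i₀ ∈ R := Relation.ReflTransGen.refl
  have hj₀ : j₀ ∉ R := fun h => (canon_lt_top_of_reflTransGen h).ne htop
  refine ⟨_, ht.delay_compl (R := R) (fun i hi j hij hlt => hi.tail ⟨hij, hlt⟩)
    (D.add_mem hKD (ht.1 i₀)) (add_nonneg hK (ht.2.1 i₀)), ?_⟩
  rw [if_neg hj₀, if_pos hi₀]
  linarith [ht.2.1 j₀]
end
end
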